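/- Let G be a Garside group with Garside element Δ and set 𝒟 of simple elements. For every g ∈ G, the translation number of the image ḡ in the quotient G_Δ = G/⟨Δ^{m₀}⟩ with respect to 𝒟̄ ∪ 𝒟̄⁻¹ exists and equals t_len(g). -/

import Mathlib

open Filter Topology Pointwise

/-- Left divisibility order on a group relative to a submonoid `P` of positive elements:
`a ≤_L b` iff `a⁻¹ * b ∈ P`. -/
def leL {G : Type*} [Group G] (P : Submonoid G) (a b : G) : Prop := a⁻¹ * b ∈ P

/-- Right divisibility order: `a ≤_R b` iff `b * a⁻¹ ∈ P`. -/
def leR {G : Type*} [Group G] (P : Submonoid G) (a b : G) : Prop := b * a⁻¹ ∈ P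

/-- An atom of the positive monoid `P`: a nontrivial element admitting no nontrivial
factorization inside `P`. -/
def IsMonAtom {G : Type*} [Group G] (P : Submonoid G) (a : G) : Prop :=
  a ∈ P ∧ a ≠ 1 ∧ ∀ b c : G, b ∈ P → c ∈ P → a = b * c → b = 1 ∨ c = 1

/-- `a` can be written as a product of `n` atoms of `P`. -/
def IsAtomProd {G : Type*} [Group G] (P : Submonoid G) (n : ℕ) (a : G) : Prop :=
  ∃ l : List G, l.length = n ∧ (∀ x ∈ l, IsMonAtom P x) ∧ l.prod = a

/-- A Garside structure on a group `G`: `G` is the group of fractions of the positive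
monoid `P`, which is a finitely generated atomic monoid (with atomic norm `norm`),
a lattice for both `≤_L` and `≤_R`, equipped with a Garside element `Δ` whose left and
right divisors coincide and generate `P`.  The fields `zinf`, `zsup`, `infs`, `sups`,
`tinf`, `tsup` are the (uniquely determined) invariants
`inf g = max {r : Δ^r ≤_L g}`, `sup g = min {s : g ≤_L Δ^s}`,
`inf_s g = max {inf h : h ∈ [g]}`, `sup_s g = min {sup h : h ∈ [g]}`,
`t_inf g = lim inf(gⁿ)/n` and `t_sup g = lim sup(gⁿ)/n`,
each given together with its defining specification. -/
structure GarsideGroup (G : Type*) [Group G] where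
  P : Submonoid G
  /-- `G` is the group of fractions of `P`. -/
  fraction : ∀ g : G, ∃ a b : G, a ∈ P ∧ b ∈ P ∧ g = a⁻¹ * b
  /-- `P` is finitely generated. -/
  fg : P.FG
  /-- the atomic norm `‖·‖` -/
  norm : G → ℕ
  /-- `P` is atomic: every positive element is a product of atoms and `norm a` is the
  greatest length of such an expression. -/
  norm_spec : ∀ a ∈ P, IsGreatest {n : ℕ | IsAtomProd P n a} (norm a)
  /-- `(P, ≤_L)` is a lattice: gcd's and lcm's exist. -/
  latticeL : ∀ a ∈ P, ∀ b ∈ P,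
    (∃ c ∈ P, leL P c a ∧ leL P c b ∧ ∀ d ∈ P, leL P d a → leL P d b → leL P d c) ∧
    (∃ c ∈ P, leL P a c ∧ leL P b c ∧ ∀ d ∈ P, leL P a d → leL P b d → leL P c d)
  /-- `(P, ≤_R)` is a lattice. -/
  latticeR : ∀ a ∈ P, ∀ b ∈ P,
    (∃ c ∈ P, leR P c a ∧ leR P c b ∧ ∀ d ∈ P, leR P d a → leR P d b → leR P d c) ∧
    (∃ c ∈ P, leR P a c ∧ leR P b c ∧ ∀ d ∈ P, leR P a d → leR P b d → leR P c d)
  /-- the Garside element -/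
  Δ : G
  Δ_mem : Δ ∈ P
  /-- the left and right divisors of `Δ` coincide -/
  Δ_balanced : ∀ a ∈ P, (leL P a Δ ↔ leR P a Δ)
  /-- the simple elements generate `P` -/
  simples_gen : Submonoid.closure {a : G | a ∈ P ∧ leL P a Δ} = P
  /-- `inf g = max {r : ℤ | Δ^r ≤_L g}` -/
  zinf : G → ℤ
  /-- `sup g = min {s : ℤ | g ≤_L Δ^s}` -/
  zsup : G → ℤ
  zinf_spec : ∀ g : G, IsGreatest {r : ℤ | leL P (Δ ^ r) g} (zinf g)
  zsup_spec : ∀ g : G, IsLeast {s : ℤ | leL P g (Δ ^ s)} (zsup g)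
  /-- `inf_s g = max {inf h : h ∈ [g]}` -/
  infs : G → ℤ
  /-- `sup_s g = min {sup h : h ∈ [g]}` -/
  sups : G → ℤ
  infs_spec : ∀ g : G, IsGreatest (Set.range fun h : G => zinf (h⁻¹ * g * h)) (infs g)
  sups_spec : ∀ g : G, IsLeast (Set.range fun h : G => zsup (h⁻¹ * g * h)) (sups g)
  /-- `t_inf g = lim_{n → ∞} inf(gⁿ)/n` -/
  tinf : G → ℝ
  /-- `t_sup g = lim_{n → ∞} sup(gⁿ)/n` -/
  tsup : G → ℝ
  tinf_spec : ∀ g : G,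
    Filter.Tendsto (fun n : ℕ => (zinf (g ^ n) : ℝ) / (n : ℝ)) Filter.atTop (nhds (tinf g))
  tsup_spec : ∀ g : G,
    Filter.Tendsto (fun n : ℕ => (zsup (g ^ n) : ℝ) / (n : ℝ)) Filter.atTop (nhds (tsup g))

namespace GarsideGroup

variable {G : Type*} [Group G] (Γ : GarsideGroup G)

/-- The set `𝒟` of simple elements. -/
def simples : Set G := {a : G | a ∈ Γ.P ∧ leL Γ.P a Γ.Δ}

/-- `len g = sup g - inf g` -/
def len (g : G) : ℤ := Γ.zsup g - Γ.zinf g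

/-- `t_len g = t_sup g - t_inf g` -/
noncomputable def tlen (g : G) : ℝ := Γ.tsup g - Γ.tinf g

/-- `g` is inf-straight if `inf g = t_inf g`. -/
def InfStraight (g : G) : Prop := (Γ.zinf g : ℝ) = Γ.tinf g

/-- `g` is sup-straight if `sup g = t_sup g`. -/
def SupStraight (g : G) : Prop := (Γ.zsup g : ℝ) = Γ.tsup g

/-- The super summit set `[g]^S`. -/
def superSummit (g : G) : Set G :=
  {h : G | (∃ x : G, x⁻¹ * g * x = h) ∧ Γ.zinf h = Γ.infs g ∧ Γ.zsup h = Γ.sups g}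

end GarsideGroup

/-- The shortest length of a word over the alphabet `X` representing `g`. -/
noncomputable def wlen {G : Type*} [Group G] (X : Set G) (g : G) : ℕ :=
  sInf {n : ℕ | ∃ l : List G, l.length = n ∧ (∀ x ∈ l, x ∈ X) ∧ l.prod = g}

namespace GarsideGroup

variable {G : Type*} [Group G] (Γ : GarsideGroup G)

theorem conj_mem (a : G) (ha : a ∈ Γ.P) :
    Γ.Δ⁻¹ * a * Γ.Δ ∈ Γ.P ∧ Γ.Δ * a * Γ.Δ⁻¹ ∈ Γ.P := by
  have h : a ∈ Submonoid.closure {a : G | a ∈ Γ.P ∧ leL Γ.P a Γ.Δ} := by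
    rw [Γ.simples_gen]; exact ha
  induction h using Submonoid.closure_induction with
  | mem x hx =>
    obtain ⟨hxP, hxL⟩ := hx
    constructor
    · have h1 : leL Γ.P (x⁻¹ * Γ.Δ) Γ.Δ := by
        rw [Γ.Δ_balanced _ hxL]
        simpa [leR] using hxP
      simpa [leL, mul_assoc] using h1
    · have hxR := (Γ.Δ_balanced _ hxP).1 hxL
      have h1 : leR Γ.P (Γ.Δ * x⁻¹) Γ.Δ := by
        rw [← Γ.Δ_balanced _ hxR]
        simpa [leL] using hxP
      simpa [leR, mul_assoc] using h1
  | one => simp [Γ.P.one_mem]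
  | mul x y hx hy ihx ihy =>
    rw [Γ.simples_gen] at hx hy
    constructor
    · have := Γ.P.mul_mem (ihx hx).1 (ihy hy).1
      simpa [mul_assoc] using this
    · have := Γ.P.mul_mem (ihx hx).2 (ihy hy).2
      simpa [mul_assoc] using this

theorem conj_pow_mem (n : ℕ) (a : G) (ha : a ∈ Γ.P) :
    (Γ.Δ ^ n)⁻¹ * a * Γ.Δ ^ n ∈ Γ.P ∧ Γ.Δ ^ n * a * (Γ.Δ ^ n)⁻¹ ∈ Γ.P := by
  induction n generalizing a with
  | zero => simpa using ha
  | succ n ih =>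
    constructor
    · have := (ih _ (Γ.conj_mem a ha).1).1
      simpa [pow_succ', mul_assoc] using this
    · have := (ih _ (Γ.conj_mem a ha).2).2
      simpa [pow_succ, mul_assoc] using this

theorem conj_zpow_mem (n : ℤ) (a : G) (ha : a ∈ Γ.P) :
    (Γ.Δ ^ n)⁻¹ * a * Γ.Δ ^ n ∈ Γ.P := by
  obtain ⟨k, rfl | rfl⟩ := n.eq_nat_or_neg
  · simpa using (Γ.conj_pow_mem k a ha).1
  · simpa using (Γ.conj_pow_mem k a ha).2

theorem exists_simples (k : ℕ) (p : G) (hp : p ∈ Γ.P) (hk : p⁻¹ * Γ.Δ ^ k ∈ Γ.P) :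
    ∃ l : List G, l.length = k ∧ (∀ x ∈ l, x ∈ Γ.simples) ∧ l.prod = p := by
  induction k generalizing p with
  | zero =>
    refine ⟨[], rfl, by simp, ?_⟩
    have hk' : p⁻¹ ∈ Γ.P := by simpa using hk
    by_contra hne
    have hp1 : p ≠ 1 := fun h => hne (by simp [h])
    obtain ⟨⟨l, hl, hat, hpr⟩, -⟩ := Γ.norm_spec p hp
    obtain ⟨⟨l', hl', hat', hpr'⟩, -⟩ := Γ.norm_spec _ hk'
    cases l with
    | nil => exact hp1 (by simpa using hpr.symm)
    | cons a t =>
      have h2 := (Γ.norm_spec 1 Γ.P.one_mem).2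
      have h3 : ∀ m : ℕ, IsAtomProd Γ.P (((a :: t) ++ l').length * m) 1 := by
        intro m
        refine ⟨(List.replicate m ((a :: t) ++ l')).flatten, ?_, ?_, ?_⟩
        · simp [mul_comm]
        · intro x hx
          rw [List.mem_flatten] at hx
          obtain ⟨u, hu, hxu⟩ := hx
          rw [List.eq_of_mem_replicate hu, List.mem_append] at hxu
          exact hxu.elim (hat x) (hat' x)
        · rw [List.prod_flatten, List.map_replicate, List.prod_replicate, List.prod_append, hpr,
            hpr']
          simp
      have h4 := h2 (h3 (Γ.norm 1 + 1))
      simp only [List.length_append, List.length_cons] at h4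
      nlinarith
  | succ k ih =>
    have hΔk : Γ.Δ ^ k ∈ Γ.P := Γ.P.pow_mem Γ.Δ_mem k
    obtain ⟨⟨p', hp', hp'p, hp'k, hmax⟩, -⟩ := Γ.latticeL p hp _ hΔk
    obtain ⟨⟨c, hc, hcp, hck, hcmax⟩, -⟩ :=
      Γ.latticeL (p * Γ.Δ) (Γ.P.mul_mem hp Γ.Δ_mem) (Γ.Δ ^ (k+1)) (Γ.P.pow_mem Γ.Δ_mem _)
    have h1 : leL Γ.P p c := hcmax p hp (by simpa [leL] using Γ.Δ_mem) hk
    have h2 : leL Γ.P Γ.Δ c := by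
      refine hcmax _ Γ.Δ_mem ?_ ?_
      · simpa [leL, mul_assoc] using (Γ.conj_mem p hp).1
      · simpa [leL, pow_succ'] using hΔk
    have h3 : c * Γ.Δ⁻¹ ∈ Γ.P := by
      have := (Γ.conj_mem _ h2).2
      simpa [mul_assoc] using this
    have h4 : leL Γ.P (c * Γ.Δ⁻¹) p' := by
      refine hmax _ h3 ?_ ?_
      · have := (Γ.conj_mem _ hcp).2
        simpa [leL, mul_assoc] using this
      · have := (Γ.conj_mem _ hck).2
        simpa [leL, mul_assoc, pow_succ] using this
    have h5 : leL Γ.P p (p' * Γ.Δ) := by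
      have := Γ.P.mul_mem h1 (Γ.conj_mem _ h4).1
      simpa [leL, mul_assoc] using this
    obtain ⟨l, hl, hs, hpr⟩ := ih p' hp' hp'k
    refine ⟨l ++ [p'⁻¹ * p], by simp [hl], ?_, by simp [hpr]⟩
    intro x hx
    rw [List.mem_append] at hx
    rcases hx with hx | hx
    · exact hs x hx
    · rw [List.mem_singleton] at hx
      subst hx
      exact ⟨hp'p, by simpa [leL, mul_assoc] using h5⟩

/-- `h` lies between `Δ^r` and `Δ^s`. -/
def Between (r s : ℤ) (h : G) : Prop := (Γ.Δ ^ r)⁻¹ * h ∈ Γ.P ∧ h⁻¹ * Γ.Δ ^ s ∈ Γ.P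

theorem Between.mul {Γ : GarsideGroup G} {r s r' s' : ℤ} {h h' : G} (H : Γ.Between r s h)
    (H' : Γ.Between r' s' h') : Γ.Between (r + r') (s + s') (h * h') := by
  constructor
  · have := Γ.P.mul_mem (Γ.conj_zpow_mem r' _ H.1) H'.1
    simpa [zpow_add, mul_assoc] using this
  · have := Γ.P.mul_mem H'.2 (Γ.conj_zpow_mem s' _ H.2)
    simpa [zpow_add, mul_assoc] using this

theorem between_zpow (r : ℤ) : Γ.Between r r (Γ.Δ ^ r) := by
  simp [Between, Γ.P.one_mem]

theorem between_simple {x : G} (hx : x ∈ Γ.simples) : Γ.Between 0 1 x := by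
  refine ⟨by simpa using hx.1, by simpa [leL] using hx.2⟩

theorem between_simple_inv {x : G} (hx : x ∈ Γ.simples) : Γ.Between (-1) 0 x⁻¹ := by
  refine ⟨?_, by simpa using hx.1⟩
  have := (Γ.Δ_balanced x hx.1).1 hx.2
  simpa [leR] using this

theorem len_le {r s : ℤ} {h : G} (H : Γ.Between r s h) : Γ.len h ≤ s - r := by
  have h1 := (Γ.zinf_spec h).2 H.1
  have h2 := (Γ.zsup_spec h).2 H.2
  unfold len
  linarith

theorem between_self (h : G) : Γ.Between (Γ.zinf h) (Γ.zsup h) h :=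
  ⟨(Γ.zinf_spec h).1, (Γ.zsup_spec h).1⟩

theorem len_nonneg (h : G) : 0 ≤ Γ.len h := by
  by_contra hneg
  obtain ⟨h1, h2⟩ := Γ.between_self h
  obtain ⟨k, hk⟩ : ∃ k : ℕ, Γ.zinf h = Γ.zsup h + k + 1 := by
    unfold len at hneg
    exact ⟨(Γ.zinf h - Γ.zsup h - 1).toNat, by omega⟩
  have h3 := Γ.P.mul_mem h1 h2
  have h4 := Γ.P.mul_mem (Γ.P.pow_mem Γ.Δ_mem k) h3
  have h5 : Γ.Δ ^ k * ((Γ.Δ ^ Γ.zinf h)⁻¹ * h * (h⁻¹ * Γ.Δ ^ Γ.zsup h)) = Γ.Δ⁻¹ := by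
    rw [hk, ← zpow_natCast]
    have : Γ.Δ⁻¹ = Γ.Δ ^ (-1 : ℤ) := by simp
    rw [this, mul_assoc, mul_inv_cancel_left, ← zpow_neg, ← zpow_add, ← zpow_add]
    congr 1
    ring
  rw [h5] at h4
  have h6 := (Γ.zinf_spec h).2 (show leL Γ.P (Γ.Δ ^ (Γ.zinf h + 1)) h by
    have := Γ.P.mul_mem h4 h1
    simpa [leL, zpow_add, mul_assoc] using this)
  omega

theorem Δ_simple : Γ.Δ ∈ Γ.simples := ⟨Γ.Δ_mem, by simp [leL, Γ.P.one_mem]⟩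

section quot

variable (m₀ : ℕ) [(Subgroup.zpowers (Γ.Δ ^ m₀)).Normal]

/-- The generating set of the quotient. -/
def qgen : Set (G ⧸ Subgroup.zpowers (Γ.Δ ^ m₀)) :=
  (QuotientGroup.mk' (Subgroup.zpowers (Γ.Δ ^ m₀)) '' Γ.simples) ∪
    (QuotientGroup.mk' (Subgroup.zpowers (Γ.Δ ^ m₀)) '' Γ.simples)⁻¹

theorem exists_word (hm : 0 < m₀) (h : G) :
    ∃ l : List (G ⧸ Subgroup.zpowers (Γ.Δ ^ m₀)), (l.length : ℤ) ≤ Γ.len h + m₀ ∧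
      (∀ x ∈ l, x ∈ Γ.qgen m₀) ∧ l.prod = QuotientGroup.mk' (Subgroup.zpowers (Γ.Δ ^ m₀)) h := by
  set π := QuotientGroup.mk' (Subgroup.zpowers (Γ.Δ ^ m₀)) with hπ
  obtain ⟨h1, h2⟩ := Γ.between_self h
  obtain ⟨k, hk⟩ := Int.eq_ofNat_of_zero_le (Γ.len_nonneg h)
  have hk' : Γ.zsup h = Γ.zinf h + k := by unfold len at hk; omega
  obtain ⟨l, hl, hs, hpr⟩ := Γ.exists_simples k _ h1 (by
    rw [← zpow_natCast]
    rw [hk', zpow_add] at h2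
    simpa [mul_assoc] using h2)
  have hm' : (m₀ : ℤ) ≠ 0 := by omega
  obtain ⟨t, ht⟩ := Int.eq_ofNat_of_zero_le (Int.emod_nonneg (Γ.zinf h) hm')
  have htlt : (t : ℤ) < m₀ := by
    rw [← ht]; exact Int.emod_lt_of_pos _ (by omega)
  have hΔ : π Γ.Δ ^ m₀ = 1 := by
    rw [← map_pow, hπ, QuotientGroup.mk'_apply, QuotientGroup.eq_one_iff]
    exact Subgroup.mem_zpowers _
  have hΔr : π (Γ.Δ ^ Γ.zinf h) = π Γ.Δ ^ t := by
    have := Int.emod_add_mul_ediv (Γ.zinf h) m₀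
    rw [← this, ht, zpow_add, zpow_mul, map_mul, map_zpow, map_zpow, map_zpow, zpow_natCast,
      zpow_natCast, hΔ]
    simp
  refine ⟨List.replicate t (π Γ.Δ) ++ l.map π, ?_, ?_, ?_⟩
  · simp [hl]; omega
  · intro x hx
    rw [List.mem_append] at hx
    rcases hx with hx | hx
    · rw [List.eq_of_mem_replicate hx]
      exact Or.inl ⟨_, Γ.Δ_simple, rfl⟩
    · rw [List.mem_map] at hx
      obtain ⟨y, hy, rfl⟩ := hx
      exact Or.inl ⟨_, hs y hy, rfl⟩
  · rw [List.prod_append, List.prod_replicate, ← map_list_prod, hpr, ← hΔr, ← map_mul]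
    simp

theorem between_word (l : List (G ⧸ Subgroup.zpowers (Γ.Δ ^ m₀)))
    (hl : ∀ x ∈ l, x ∈ Γ.qgen m₀) :
    ∃ (h : G) (r : ℤ), QuotientGroup.mk' (Subgroup.zpowers (Γ.Δ ^ m₀)) h = l.prod ∧
      Γ.Between r (r + l.length) h := by
  induction l with
  | nil => exact ⟨1, 0, by simp, by simpa using Γ.between_zpow 0⟩
  | cons a t ih =>
    obtain ⟨h, r, hh, hb⟩ := ih (fun x hx => hl x (List.mem_cons_of_mem _ hx))
    rcases hl a List.mem_cons_self with ⟨y, hy, hya⟩ | ⟨y, hy, hya⟩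
    · refine ⟨y * h, 0 + r, by rw [map_mul, hh, hya, List.prod_cons], ?_⟩
      convert (Γ.between_simple hy).mul hb using 1
      push_cast [List.length_cons]; ring
    · refine ⟨y⁻¹ * h, -1 + r, by rw [map_mul, map_inv, hh, hya, List.prod_cons, inv_inv], ?_⟩
      convert (Γ.between_simple_inv hy).mul hb using 1
      push_cast [List.length_cons]; ring

theorem wlen_bounds (hm : 0 < m₀) (h : G) :
    Γ.len h ≤ wlen (Γ.qgen m₀) (QuotientGroup.mk' (Subgroup.zpowers (Γ.Δ ^ m₀)) h) ∧
    (wlen (Γ.qgen m₀) (QuotientGroup.mk' (Subgroup.zpowers (Γ.Δ ^ m₀)) h) : ℤ)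
      ≤ Γ.len h + m₀ := by
  obtain ⟨l, hlen, hl, hpr⟩ := Γ.exists_word m₀ hm h
  have hmem : l.length ∈ {n : ℕ | ∃ l : List (G ⧸ Subgroup.zpowers (Γ.Δ ^ m₀)), l.length = n ∧
      (∀ x ∈ l, x ∈ Γ.qgen m₀) ∧
      l.prod = QuotientGroup.mk' (Subgroup.zpowers (Γ.Δ ^ m₀)) h} := ⟨l, rfl, hl, hpr⟩
  constructor
  · obtain ⟨l', hlen', hl', hpr'⟩ := Nat.sInf_mem ⟨_, hmem⟩
    obtain ⟨u, r, hu, hb⟩ := Γ.between_word m₀ l' hl'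
    rw [hpr', QuotientGroup.mk'_apply, QuotientGroup.mk'_apply, QuotientGroup.eq,
      Subgroup.mem_zpowers_iff] at hu
    obtain ⟨j, hj⟩ := hu
    have hh : h = u * Γ.Δ ^ ((m₀ : ℤ) * j) := by
      rw [zpow_mul, zpow_natCast, hj]; simp
    have hb' := Γ.len_le (hb.mul (Γ.between_zpow ((m₀ : ℤ) * j)))
    rw [← hh] at hb'
    unfold wlen
    rw [← hlen']
    linarith
  · refine le_trans ?_ hlen
    exact_mod_cast Nat.sInf_le hmem

end quot

end GarsideGroup

/-- for every `g ∈ G`, the translation number of `ḡ` in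
`G_Δ = G/⟨Δ^{m₀}⟩` w.r.t. `𝒟̄ ∪ 𝒟̄⁻¹` exists and equals `t_len(g)`. -/
theorem statement15 {G : Type*} [Group G] (Γ : GarsideGroup G) (m₀ : ℕ)
    (hm₀ : IsLeast {m : ℕ | 0 < m ∧ ∀ x : G, Commute (Γ.Δ ^ m) x} m₀)
    [(Subgroup.zpowers (Γ.Δ ^ m₀)).Normal] (g : G) :
    Filter.Tendsto
      (fun n : ℕ =>
        (wlen ((QuotientGroup.mk' (Subgroup.zpowers (Γ.Δ ^ m₀)) '' Γ.simples) ∪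
            (QuotientGroup.mk' (Subgroup.zpowers (Γ.Δ ^ m₀)) '' Γ.simples)⁻¹)
          ((QuotientGroup.mk' (Subgroup.zpowers (Γ.Δ ^ m₀)) g) ^ n) : ℝ) / (n : ℝ))
      Filter.atTop (nhds (Γ.tlen g)) := by
  have hm : 0 < m₀ := hm₀.1.1
  have hlim : Filter.Tendsto (fun n : ℕ => (Γ.len (g ^ n) : ℝ) / (n : ℝ)) Filter.atTop
      (nhds (Γ.tlen g)) := by
    have := (Γ.tsup_spec g).sub (Γ.tinf_spec g)
    refine this.congr fun n => ?_
    simp only [GarsideGroup.len]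
    push_cast
    ring
  have hlim2 : Filter.Tendsto (fun n : ℕ => (Γ.len (g ^ n) : ℝ) / (n : ℝ) + (m₀ : ℝ) / (n : ℝ))
      Filter.atTop (nhds (Γ.tlen g)) := by
    simpa using hlim.add (tendsto_const_div_atTop_nhds_zero_nat (m₀ : ℝ))
  refine tendsto_of_tendsto_of_tendsto_of_le_of_le hlim hlim2 ?_ ?_
  · intro n
    have h := (Γ.wlen_bounds m₀ hm (g ^ n)).1
    rw [map_pow] at h
    have h' : (Γ.len (g ^ n) : ℝ) ≤
        (wlen (Γ.qgen m₀) ((QuotientGroup.mk' (Subgroup.zpowers (Γ.Δ ^ m₀))) g ^ n) : ℝ) := by exact_mod_cast h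
    exact div_le_div_of_nonneg_right h' (Nat.cast_nonneg n)
  · intro n
    have h := (Γ.wlen_bounds m₀ hm (g ^ n)).2
    rw [map_pow] at h
    have h' : (wlen (Γ.qgen m₀) ((QuotientGroup.mk' (Subgroup.zpowers (Γ.Δ ^ m₀))) g ^ n) : ℝ) ≤
        (Γ.len (g ^ n) : ℝ) + (m₀ : ℝ) := by exact_mod_cast h
    have h2 := div_le_div_of_nonneg_right h' (Nat.cast_nonneg (α := ℝ) n)
    rw [add_div] at h2
    exact h2
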